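/- arXiv:1802.10052 — 2 statements merged into one kernel-verified Lean document; each statement's English description precedes it below -/
import Mathlib

section
/- Let H ∈ ℂ^{n×n} be Hermitian and L₁, …, L_K ∈ ℂ^{n×n} arbitrary, and let 𝓛 be the associated Lindblad superoperator. Then every eigenvalue μ ∈ ℂ of the matrix 𝓛 satisfies Re(μ) ≤ 0. -/
open Matrix
open scoped Kronecker

/-- The Lindblad superoperator
`𝓛 = −i(H ⊗ I − I ⊗ Hᵀ) + Σ_ν (L_ν ⊗ conj(L_ν) − ½(L_νᴴL_ν ⊗ I + I ⊗ (L_νᴴL_ν)ᵀ))`. -/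
noncomputable def lindbladSuper {n K : ℕ} (H : Matrix (Fin n) (Fin n) ℂ)
    (L : Fin K → Matrix (Fin n) (Fin n) ℂ) :
    Matrix (Fin n × Fin n) (Fin n × Fin n) ℂ :=
  (-Complex.I) •
      (H ⊗ₖ (1 : Matrix (Fin n) (Fin n) ℂ) - (1 : Matrix (Fin n) (Fin n) ℂ) ⊗ₖ Hᵀ) +
    ∑ ν, (L ν ⊗ₖ (L ν).map (starRingEnd ℂ) -
      (1 / 2 : ℂ) • (((L ν)ᴴ * L ν) ⊗ₖ (1 : Matrix (Fin n) (Fin n) ℂ) +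
        (1 : Matrix (Fin n) (Fin n) ℂ) ⊗ₖ ((L ν)ᴴ * L ν)ᵀ))

/-- The adjoint (Heisenberg picture) Lindblad generator, as a map on matrices. -/
noncomputable def lindbladAdjoint {n K : ℕ} (H : Matrix (Fin n) (Fin n) ℂ)
    (L : Fin K → Matrix (Fin n) (Fin n) ℂ) (X : Matrix (Fin n) (Fin n) ℂ) :
    Matrix (Fin n) (Fin n) ℂ :=
  (-Complex.I) • (X * H - H * X) +
    ∑ ν, ((L ν)ᴴ * X * L ν - (1 / 2 : ℂ) • (X * ((L ν)ᴴ * L ν) + (L ν)ᴴ * L ν * X))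

section LindbladAdjoint

open scoped ComplexOrder

variable {n K : ℕ} (H : Matrix (Fin n) (Fin n) ℂ) (L : Fin K → Matrix (Fin n) (Fin n) ℂ)

lemma vec_vecMul_lindbladSuper (X : Matrix (Fin n) (Fin n) ℂ) :
    vec X ᵥ* lindbladSuper H L = vec (lindbladAdjoint H L X) := by
  have hc (M : Matrix (Fin n) (Fin n) ℂ) : (M.map (starRingEnd ℂ))ᵀ = Mᴴ := rfl
  simp only [lindbladSuper, lindbladAdjoint, vecMul_add, vecMul_sub, vecMul_smul, vecMul_sum,
    vec_vecMul_kronecker, vec_add, vec_sub, vec_smul, vec_sum, transpose_one, transpose_transpose,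
    Matrix.one_mul, Matrix.mul_one, hc]

lemma lindbladAdjoint_smul_one_sub (c : ℂ) (X : Matrix (Fin n) (Fin n) ℂ) :
    lindbladAdjoint H L (c • 1 - X) = -lindbladAdjoint H L X := by
  simp only [lindbladAdjoint, neg_add, ← Finset.sum_neg_distrib]
  congr 1
  · simp only [sub_mul, mul_sub, smul_mul_assoc, mul_smul_comm, one_mul, mul_one]
    module
  · refine Finset.sum_congr rfl fun ν _ ↦ ?_
    simp only [sub_mul, mul_sub, smul_mul_assoc, mul_smul_comm, one_mul, mul_one]
    module

variable {H} in
lemma conjTranspose_lindbladAdjoint (hH : H.IsHermitian) (X : Matrix (Fin n) (Fin n) ℂ) :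
    (lindbladAdjoint H L X)ᴴ = lindbladAdjoint H L Xᴴ := by
  simp only [lindbladAdjoint, conjTranspose_add, conjTranspose_sum, conjTranspose_sub,
    conjTranspose_smul, conjTranspose_mul, conjTranspose_conjTranspose, hH.eq]
  congr 1
  · simp only [star_neg, Complex.star_def, Complex.conj_I]
    module
  · refine Finset.sum_congr rfl fun ν _ ↦ ?_
    simp only [mul_assoc, star_div₀, star_one, star_ofNat]
    module

/-- Lindblad's dissipation identity. -/
lemma lindbladAdjoint_mul (X Y : Matrix (Fin n) (Fin n) ℂ) :
    lindbladAdjoint H L (X * Y) =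
      lindbladAdjoint H L X * Y + X * lindbladAdjoint H L Y +
        ∑ ν, ((L ν)ᴴ * X - X * (L ν)ᴴ) * (Y * L ν - L ν * Y) := by
  simp only [lindbladAdjoint, add_mul, mul_add, Finset.sum_mul, Finset.mul_sum]
  rw [add_add_add_comm, add_assoc, ← Finset.sum_add_distrib, ← Finset.sum_add_distrib]
  congr 1
  · simp only [sub_mul, mul_sub, smul_mul_assoc, mul_smul_comm, mul_assoc]
    module
  · refine Finset.sum_congr rfl fun ν _ ↦ ?_
    simp only [sub_mul, mul_sub, add_mul, mul_add, smul_mul_assoc, mul_smul_comm, mul_assoc]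
    module

variable {H L} in
lemma star_dotProduct_lindbladAdjoint_mulVec_nonneg {Q : Matrix (Fin n) (Fin n) ℂ}
    (hQ : Q.PosSemidef) {v : Fin n → ℂ} (hv : Q *ᵥ v = 0) :
    0 ≤ star v ⬝ᵥ (lindbladAdjoint H L Q *ᵥ v) := by
  have hv' : star v ᵥ* Q = 0 := by
    rw [← hQ.isHermitian.eq, ← star_mulVec, hv, star_zero]
  have h1 (M : Matrix (Fin n) (Fin n) ℂ) : star v ⬝ᵥ ((Q * M) *ᵥ v) = 0 := by
    rw [← mulVec_mulVec, dotProduct_mulVec, hv', zero_dotProduct]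
  have h2 (M : Matrix (Fin n) (Fin n) ℂ) : star v ⬝ᵥ ((M * Q) *ᵥ v) = 0 := by
    rw [← mulVec_mulVec, hv, mulVec_zero, dotProduct_zero]
  simp only [lindbladAdjoint, add_mulVec, sub_mulVec, smul_mulVec, sum_mulVec, dotProduct_add,
    dotProduct_sub, dotProduct_smul, dotProduct_sum, h1, h2, sub_zero, add_zero, smul_zero,
    zero_add]
  exact Finset.sum_nonneg fun ν _ ↦
    (hQ.conjTranspose_mul_mul_same (L ν)).dotProduct_mulVec_nonneg v

/-- A nonzero positive semidefinite matrix has a largest eigenvalue, which is positive. -/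
lemma Matrix.PosSemidef.exists_pos_max_eigenvalue {n : ℕ} {P : Matrix (Fin n) (Fin n) ℂ}
    (hP : P.PosSemidef) (h0 : P ≠ 0) :
    ∃ (c : ℝ) (v : Fin n → ℂ), 0 < c ∧ v ≠ 0 ∧ P *ᵥ v = (c : ℂ) • v ∧
      ((c : ℂ) • (1 : Matrix (Fin n) (Fin n) ℂ) - P).PosSemidef := by
  have hH := hP.isHermitian
  obtain ⟨j, hj⟩ : ∃ j, hH.eigenvalues j ≠ 0 := by
    by_contra! h
    exact h0 (hH.eigenvalues_eq_zero_iff.1 (funext h))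
  have : Nonempty (Fin n) := ⟨j⟩
  obtain ⟨i, hi⟩ := Finite.exists_max hH.eigenvalues
  refine ⟨hH.eigenvalues i, hH.eigenvectorBasis i, ?_, ?_, ?_, ?_⟩
  · exact ((hP.eigenvalues_nonneg j).lt_of_ne' hj).trans_le (hi j)
  · intro h
    exact hH.eigenvectorBasis.orthonormal.ne_zero i (by ext k; exact congrFun h k)
  · simpa using hH.mulVec_eigenvectorBasis i
  · rw [posSemidef_iff_isHermitian_and_spectrum_nonneg]
    refine ⟨by simp [IsHermitian, hH.eq], fun z hz ↦ ?_⟩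
    rw [← Algebra.algebraMap_eq_smul_one, ← spectrum.singleton_sub_eq,
      hH.spectrum_eq_image_range] at hz
    obtain ⟨_, rfl, _, ⟨_, ⟨k, rfl⟩, rfl⟩, rfl⟩ := hz
    simpa using hi k

/-- Eigenvalues of the adjoint Lindblad generator have nonpositive real part. -/
lemma re_nonpos_of_lindbladAdjoint_eq_smul {n K : ℕ} {H : Matrix (Fin n) (Fin n) ℂ}
    (hH : H.IsHermitian) {L : Fin K → Matrix (Fin n) (Fin n) ℂ} {μ : ℂ}
    {X : Matrix (Fin n) (Fin n) ℂ} (hX0 : X ≠ 0) (hX : lindbladAdjoint H L X = μ • X) :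
    μ.re ≤ 0 := by
  have hX' : lindbladAdjoint H L Xᴴ = star μ • Xᴴ := by
    rw [← conjTranspose_lindbladAdjoint L hH, hX, conjTranspose_smul]
  obtain ⟨c, v, hc, hv0, hv, hQ⟩ := (posSemidef_conjTranspose_mul_self X).exists_pos_max_eigenvalue
    (by simpa using hX0)
  have hGQ := star_dotProduct_lindbladAdjoint_mulVec_nonneg (H := H) (L := L) hQ (v := v)
    (by simp [sub_mulVec, smul_mulVec, hv])
  have hvv : 0 < star v ⬝ᵥ v := dotProduct_star_self_pos_iff.2 hv0
  have hC : 0 ≤ star v ⬝ᵥ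
      ((∑ ν, ((L ν)ᴴ * Xᴴ - Xᴴ * (L ν)ᴴ) * (X * L ν - L ν * X)) *ᵥ v) := by
    rw [sum_mulVec, dotProduct_sum]
    refine Finset.sum_nonneg fun ν _ ↦ ?_
    simpa using (posSemidef_conjTranspose_mul_self (X * L ν - L ν * X)).dotProduct_mulVec_nonneg v
  rw [lindbladAdjoint_smul_one_sub, lindbladAdjoint_mul, hX, hX', neg_mulVec, dotProduct_neg,
    add_mulVec, dotProduct_add, smul_mul_assoc, mul_smul_comm, ← add_smul, smul_mulVec, hv,
    dotProduct_smul, dotProduct_smul] at hGQ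
  have h := (Complex.le_def.1 (add_nonneg hGQ hC)).1
  obtain ⟨hr, him⟩ := Complex.lt_def.1 hvv
  simp only [Complex.zero_re, Complex.zero_im] at hr him
  simp [← him] at h
  have := mul_pos hc hr
  nlinarith

end LindbladAdjoint

/-- If `H` is Hermitian, every eigenvalue `μ` of the Lindblad superoperator `𝓛` satisfies
`Re μ ≤ 0`. -/
theorem re_nonpos_of_mem_spectrum_lindbladSuper {n K : ℕ}
    (H : Matrix (Fin n) (Fin n) ℂ) (hH : H.IsHermitian)
    (L : Fin K → Matrix (Fin n) (Fin n) ℂ)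
    (μ : ℂ) (hμ : μ ∈ spectrum ℂ (lindbladSuper H L)) :
    μ.re ≤ 0 := by
  obtain ⟨X, hX0, hX⟩ : ∃ X, X ≠ 0 ∧ lindbladAdjoint H L X = μ • X := by
    rw [spectrum.mem_iff, isUnit_iff_isUnit_det, isUnit_iff_ne_zero, not_not,
      ← exists_vecMul_eq_zero_iff] at hμ
    obtain ⟨w, hw0, hw⟩ := hμ
    obtain ⟨X, rfl⟩ := vec_bijective.surjective w
    refine ⟨X, by rintro rfl; simp at hw0, ?_⟩
    rw [vecMul_sub, vec_vecMul_lindbladSuper, sub_eq_zero, Algebra.algebraMap_eq_smul_one,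
      vecMul_smul, vecMul_one, ← vec_smul] at hw
    exact (vec_inj.1 hw).symm
  exact re_nonpos_of_lindbladAdjoint_eq_smul hH hX0 hX
end

section
/- Let H, N ∈ ℂ^{n×n} be Hermitian with HN = NH, let L₁, …, L_K ∈ ℂ^{n×n} satisfy N L_ν − L_ν N = −L_ν for each ν and Σ_ν L_νᴴ L_ν = N, and let γ ∈ ℝ. Suppose ρ : ℝ → ℂ^{n×n} is differentiable and satisfies the Lindblad master equation ρ'(t) = −i(Hρ(t) − ρ(t)H) + γ Σ_ν (L_ν ρ(t) L_νᴴ − ½(L_νᴴ L_ν ρ(t) + ρ(t) L_νᴴ L_ν)) for all t. Then the number of excitations N(t) := trace(N ρ(t)) decays exponentially: trace(N ρ(t)) = e^{−γt} · trace(N ρ(0)) for all t ≥ 0. -/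
open Matrix

/-- A Hamiltonian commuting with the observable `N` does not contribute to the evolution of
its expectation value. -/
theorem trace_mul_commutator_eq_zero {n : Type*} [Fintype n] {H N : Matrix n n ℂ}
    (hHN : H * N = N * H) (ρ : Matrix n n ℂ) : (N * (H * ρ - ρ * H)).trace = 0 := by
  rw [mul_sub, trace_sub, ← mul_assoc, ← mul_assoc, trace_mul_comm (N * ρ) H, ← mul_assoc, hHN,
    sub_self]

/-- The trace of a number operator against the dissipator of a lowering operator. -/
theorem trace_mul_dissipator {n : Type*} [Fintype n] {N L : Matrix n n ℂ}
    (hLow : N * L - L * N = -L) (ρ : Matrix n n ℂ) :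
    (N * (L * ρ * Lᴴ - (1 / 2 : ℂ) • (Lᴴ * L * ρ + ρ * (Lᴴ * L)))).trace =
      (1 / 2 : ℂ) * ((Lᴴ * L * (N * ρ)).trace - (Lᴴ * L * (ρ * N)).trace) -
        (Lᴴ * L * ρ).trace := by
  have hNL : N * L = L * N - L := by
    rw [sub_eq_iff_eq_add] at hLow
    rw [hLow, neg_add_eq_sub]
  have hjump : (N * (L * ρ * Lᴴ)).trace = (Lᴴ * L * (N * ρ)).trace - (Lᴴ * L * ρ).trace := by
    rw [← mul_assoc, trace_mul_comm, ← mul_assoc N, hNL, ← trace_sub]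
    congr 1
    noncomm_ring
  have hleft : (N * (Lᴴ * L * ρ)).trace = (Lᴴ * L * (ρ * N)).trace := by
    rw [trace_mul_comm, mul_assoc]
  have hright : (N * (ρ * (Lᴴ * L))).trace = (Lᴴ * L * (N * ρ)).trace := by
    rw [← mul_assoc, trace_mul_comm]
  rw [mul_sub, trace_sub, mul_smul_comm, trace_smul, mul_add, trace_add, hjump, hleft, hright,
    smul_eq_mul]
  ring

/-- The trace of a number operator against the full dissipator. -/
theorem trace_mul_sum_dissipator {n κ : Type*} [Fintype n] [Fintype κ] {N : Matrix n n ℂ}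
    {L : κ → Matrix n n ℂ} (hLow : ∀ ν, N * L ν - L ν * N = -(L ν))
    (hSum : ∑ ν, (L ν)ᴴ * L ν = N) (ρ : Matrix n n ℂ) :
    (N * ∑ ν, (L ν * ρ * (L ν)ᴴ -
      (1 / 2 : ℂ) • ((L ν)ᴴ * L ν * ρ + ρ * ((L ν)ᴴ * L ν)))).trace = -(N * ρ).trace := by
  have hsum (X : Matrix n n ℂ) : ∑ ν, ((L ν)ᴴ * L ν * X).trace = (N * X).trace := by
    rw [← trace_sum, ← Finset.sum_mul, hSum]
  rw [Finset.mul_sum, trace_sum, Finset.sum_congr rfl fun ν _ => trace_mul_dissipator (hLow ν) ρ,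
    Finset.sum_sub_distrib, ← Finset.mul_sum, Finset.sum_sub_distrib, hsum, hsum, hsum,
    trace_mul_comm N (ρ * N), mul_assoc ρ, trace_mul_comm ρ, mul_assoc, sub_self, mul_zero,
    zero_sub]

theorem hasDerivAt_trace_mul {n : Type*} [Fintype n] (N : Matrix n n ℂ) {ρ : ℝ → Matrix n n ℂ}
    {ρ' : Matrix n n ℂ} {t : ℝ} (h : ∀ i j, HasDerivAt (fun s => ρ s i j) (ρ' i j) t) :
    HasDerivAt (fun s => (N * ρ s).trace) (N * ρ').trace t := by
  simp only [trace, diag_apply, mul_apply]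
  exact HasDerivAt.fun_sum fun i _ => HasDerivAt.fun_sum fun j _ => (h j i).const_mul (N i j)

/-- Solutions of the scalar linear differential equation with constant coefficient `c`. -/
theorem eq_exp_mul_of_hasDerivAt {f : ℝ → ℂ} {c : ℝ}
    (hf : ∀ t, HasDerivAt f ((c : ℂ) * f t) t) (t : ℝ) :
    f t = (Real.exp (c * t) : ℂ) * f 0 := by
  have hg (s : ℝ) : HasDerivAt (fun s : ℝ => (Real.exp (-(c * s)) : ℂ) * f s) 0 s := by
    have he : HasDerivAt (fun s : ℝ => Real.exp (-(c * s))) (Real.exp (-(c * s)) * -(c * 1)) s :=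
      ((hasDerivAt_id s).const_mul c).neg.exp
    refine (he.ofReal_comp.mul (hf s)).congr_deriv ?_
    push_cast
    ring
  have hconst := is_const_of_deriv_eq_zero (fun s => (hg s).differentiableAt)
    (fun s => (hg s).deriv) t 0
  simp only [mul_zero, neg_zero, Real.exp_zero, Complex.ofReal_one, one_mul] at hconst
  rw [← hconst, ← mul_assoc, ← Complex.ofReal_mul, ← Real.exp_add, add_neg_cancel, Real.exp_zero,
    Complex.ofReal_one, one_mul]

/-- Exponential decay of the number of excitations. Let `H, N` be commuting Hermitian matrices,
let the Lindblad operators `L_ν` satisfy `[N, L_ν] = −L_ν` and `Σ_ν L_νᴴ L_ν = N`, and let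
`γ ∈ ℝ`. If `ρ : ℝ → ℂ^{n×n}` is (entrywise) differentiable and satisfies the Lindblad master
equation, then `trace (N ρ(t)) = e^{−γ t} trace (N ρ(0))` for all `t ≥ 0`. -/
theorem trace_number_exponential_decay {n K : ℕ}
    (H N : Matrix (Fin n) (Fin n) ℂ) (hH : H.IsHermitian) (hN : N.IsHermitian)
    (hHN : H * N = N * H)
    (L : Fin K → Matrix (Fin n) (Fin n) ℂ)
    (hLow : ∀ ν, N * L ν - L ν * N = -(L ν))
    (hSum : ∑ ν, (L ν)ᴴ * L ν = N)
    (γ : ℝ)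
    (ρ : ℝ → Matrix (Fin n) (Fin n) ℂ)
    (hderiv : ∀ (t : ℝ) (i j : Fin n),
      HasDerivAt (fun s => ρ s i j)
        (((-Complex.I) • (H * ρ t - ρ t * H) +
          (γ : ℂ) • ∑ ν, (L ν * ρ t * (L ν)ᴴ -
            (1 / 2 : ℂ) • ((L ν)ᴴ * L ν * ρ t + ρ t * ((L ν)ᴴ * L ν)))) i j) t) :
    ∀ t : ℝ, 0 ≤ t → (N * ρ t).trace = (Real.exp (-γ * t) : ℂ) * (N * ρ 0).trace := by
  intro t _
  refine eq_exp_mul_of_hasDerivAt (f := fun s => (N * ρ s).trace) (fun s => ?_) t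
  refine (hasDerivAt_trace_mul N (hderiv s)).congr_deriv ?_
  rw [mul_add, mul_smul_comm, mul_smul_comm, trace_add, trace_smul, trace_smul,
    trace_mul_commutator_eq_zero hHN, trace_mul_sum_dissipator hLow hSum]
  simp
end
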